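/- There exists a constant C > 0, depending only on β and N, such that for every n ≥ 1, E_{P_{n,β}} |β|S_n|/n − b|² ≤ C/n. -/

import Mathlib

open MeasureTheory Real RealInnerProductSpace

noncomputable section

def besselRatio (N : ℕ) (x : ℝ) : ℝ :=
  x / ((N : ℝ) - 1) *
      (∫ θ in (0:ℝ)..π, Real.exp (x * Real.cos θ) * Real.sin θ ^ N) /
    ∫ θ in (0:ℝ)..π, Real.exp (x * Real.cos θ) * Real.sin θ ^ (N - 2)

/-- The unit sphere `S^{N-1}` in `ℝ^N`. -/
abbrev UnitSphere (N : ℕ) := Metric.sphere (0 : EuclideanSpace ℝ (Fin N)) 1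

/-- The map on the unit sphere induced by a linear isometry of `ℝ^N`. -/
def sphereMap {N : ℕ}
    (e : EuclideanSpace ℝ (Fin N) ≃ₗᵢ[ℝ] EuclideanSpace ℝ (Fin N))
    (θ : UnitSphere N) : UnitSphere N :=
  ⟨e θ, by
    rw [mem_sphere_zero_iff_norm, e.norm_map]
    exact mem_sphere_zero_iff_norm.mp θ.2⟩

/-- Total spin `S_n(σ) = ∑ i, σ_i`. -/
def totalSpin {N n : ℕ} (σ : Fin n → UnitSphere N) : EuclideanSpace ℝ (Fin N) :=
  ∑ i, (σ i : EuclideanSpace ℝ (Fin N))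

/-- `W_n(σ) = √n (β²/(n²b²) |S_n(σ)|² - 1)`. -/
def Wspin (N n : ℕ) (β b : ℝ) (σ : Fin n → UnitSphere N) : ℝ :=
  Real.sqrt n * (β ^ 2 / ((n : ℝ) ^ 2 * b ^ 2) * ‖totalSpin σ‖ ^ 2 - 1)

/-- The (unnormalized) Gibbs weight `exp((β/(2n)) ∑_i ∑_j ⟨σ_i, σ_j⟩)`. -/
def gibbsWeight (N n : ℕ) (β : ℝ) (σ : Fin n → UnitSphere N) : ℝ :=
  Real.exp (β / (2 * n) * ∑ i, ∑ j,
    ⟪(σ i : EuclideanSpace ℝ (Fin N)), (σ j : EuclideanSpace ℝ (Fin N))⟫)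

/-- The Gibbs measure `P_{n,β}` on `(S^{N-1})^n`. -/
def gibbsMeasure (N n : ℕ) (β : ℝ) (μ : Measure (UnitSphere N))
    [IsProbabilityMeasure μ] : Measure (Fin n → UnitSphere N) :=
  (Measure.pi fun _ : Fin n => μ).withDensity fun σ =>
    ENNReal.ofReal
      (gibbsWeight N n β σ / ∫ τ, gibbsWeight N n β τ ∂(Measure.pi fun _ : Fin n => μ))

end

lemma integrable_cont {X : Type*} [TopologicalSpace X] [CompactSpace X] [MeasurableSpace X]
    [OpensMeasurableSpace X] (ν : Measure X) [IsFiniteMeasure ν] {f : X → ℝ}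
    (hf : Continuous f) : Integrable f ν :=
  hf.integrable_of_hasCompactSupport (HasCompactSupport.of_compactSpace f)

lemma continuous_sphereMap {N : ℕ}
    (e : EuclideanSpace ℝ (Fin N) ≃ₗᵢ[ℝ] EuclideanSpace ℝ (Fin N)) :
    Continuous (sphereMap e) := by
  unfold sphereMap
  exact Continuous.subtype_mk (e.continuous.comp continuous_subtype_val) _

/-- Rotation invariance of a measure on the sphere. -/
def RotInv {N : ℕ} (μ : Measure (UnitSphere N)) : Prop :=
  ∀ e : EuclideanSpace ℝ (Fin N) ≃ₗᵢ[ℝ] EuclideanSpace ℝ (Fin N),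
      Measure.map (sphereMap e) μ = μ

lemma integral_sphereMap {N : ℕ} {μ : Measure (UnitSphere N)} (hμ : RotInv μ)
    (e : EuclideanSpace ℝ (Fin N) ≃ₗᵢ[ℝ] EuclideanSpace ℝ (Fin N))
    {f : UnitSphere N → ℝ} (hf : Continuous f) :
    ∫ s, f (sphereMap e s) ∂μ = ∫ s, f s ∂μ := by
  conv_rhs => rw [← hμ e]
  rw [integral_map (continuous_sphereMap e).measurable.aemeasurable
    hf.aestronglyMeasurable]

lemma integral_odd {N : ℕ} {μ : Measure (UnitSphere N)} (hμ : RotInv μ)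
    (x v : EuclideanSpace ℝ (Fin N)) (hvx : ⟪v, x⟫ = 0) {h : ℝ → ℝ} (hh : Continuous h) :
    ∫ s : UnitSphere N, ⟪v, (s : EuclideanSpace ℝ (Fin N))⟫ *
      h ⟪x, (s : EuclideanSpace ℝ (Fin N))⟫ ∂μ = 0 := by
  set e : EuclideanSpace ℝ (Fin N) ≃ₗᵢ[ℝ] EuclideanSpace ℝ (Fin N) :=
    (ℝ ∙ v)ᗮ.reflection with he
  have hv : e v = -v := Submodule.reflection_orthogonalComplement_singleton_eq_neg v
  have hx : e x = x := by
    rw [he]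
    apply Submodule.reflection_mem_subspace_eq_self
    rw [Submodule.mem_orthogonal_singleton_iff_inner_right]
    exact hvx
  have hc : Continuous fun s : UnitSphere N => ⟪v, (s : EuclideanSpace ℝ (Fin N))⟫ *
      h ⟪x, (s : EuclideanSpace ℝ (Fin N))⟫ := by fun_prop
  have key := integral_sphereMap hμ e hc
  have h1 : ∀ s : UnitSphere N, ⟪v, (sphereMap e s : EuclideanSpace ℝ (Fin N))⟫
      = - ⟪v, (s : EuclideanSpace ℝ (Fin N))⟫ := by
    intro s
    have := e.inner_map_map v s
    rw [hv, inner_neg_left] at this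
    change ⟪v, e s⟫ = _
    linarith
  have h2 : ∀ s : UnitSphere N, ⟪x, (sphereMap e s : EuclideanSpace ℝ (Fin N))⟫
      = ⟪x, (s : EuclideanSpace ℝ (Fin N))⟫ := by
    intro s
    have := e.inner_map_map x s
    rw [hx] at this
    exact this
  simp only [h1, h2, neg_mul, integral_neg] at key
  linarith

lemma integral_transport {N : ℕ} {μ : Measure (UnitSphere N)} (hμ : RotInv μ)
    (x y : EuclideanSpace ℝ (Fin N)) (hxy : ‖x‖ = ‖y‖) {h : ℝ → ℝ} (hh : Continuous h) :
    ∫ s : UnitSphere N, h ⟪x, (s : EuclideanSpace ℝ (Fin N))⟫ ∂μ =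
    ∫ s : UnitSphere N, h ⟪y, (s : EuclideanSpace ℝ (Fin N))⟫ ∂μ := by
  set e : EuclideanSpace ℝ (Fin N) ≃ₗᵢ[ℝ] EuclideanSpace ℝ (Fin N) :=
    (ℝ ∙ (x - y))ᗮ.reflection with he
  have hx : e x = y := Submodule.reflection_sub hxy
  have hc : Continuous fun s : UnitSphere N => h ⟪y, (s : EuclideanSpace ℝ (Fin N))⟫ := by
    fun_prop
  have key := integral_sphereMap hμ e hc
  rw [← key]
  congr 1
  ext s
  have := e.inner_map_map x s
  rw [hx] at this
  rw [← this]
  rfl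

/-- Differentiation of the rotation identity. -/
lemma stein_pair {N : ℕ} {μ : Measure (UnitSphere N)} [IsProbabilityMeasure μ] (hμ : RotInv μ)
    (i j : Fin N) (hij : i ≠ j) {h h' : ℝ → ℝ} (hh : ∀ t, HasDerivAt h (h' t) t)
    (hc' : Continuous h') :
    ∫ s : UnitSphere N, (s : EuclideanSpace ℝ (Fin N)) j ^ 2 *
      h' ((s : EuclideanSpace ℝ (Fin N)) i) ∂μ =
    ∫ s : UnitSphere N, (s : EuclideanSpace ℝ (Fin N)) i *
      h ((s : EuclideanSpace ℝ (Fin N)) i) ∂μ := by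
  have hc : Continuous h := continuous_iff_continuousAt.2 fun t => (hh t).continuousAt
  let F : ℝ → UnitSphere N → ℝ := fun a s =>
    ((s : EuclideanSpace ℝ (Fin N)) j - a * (s : EuclideanSpace ℝ (Fin N)) i) *
      h ((s : EuclideanSpace ℝ (Fin N)) i + a * (s : EuclideanSpace ℝ (Fin N)) j)
  let F' : ℝ → UnitSphere N → ℝ := fun a s =>
    (- (s : EuclideanSpace ℝ (Fin N)) i) *
      h ((s : EuclideanSpace ℝ (Fin N)) i + a * (s : EuclideanSpace ℝ (Fin N)) j) +
    ((s : EuclideanSpace ℝ (Fin N)) j - a * (s : EuclideanSpace ℝ (Fin N)) i) *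
      (h' ((s : EuclideanSpace ℝ (Fin N)) i + a * (s : EuclideanSpace ℝ (Fin N)) j) *
        (s : EuclideanSpace ℝ (Fin N)) j)
  have hF0 : ∀ a, ∫ s, F a s ∂μ = 0 := by
    intro a
    have := integral_odd hμ (EuclideanSpace.single i (1:ℝ) + a • EuclideanSpace.single j (1:ℝ))
      (EuclideanSpace.single j (1:ℝ) - a • EuclideanSpace.single i (1:ℝ)) ?_ hc
    · rw [← this]
      congr 1
      ext s
      simp [F, inner_add_left, inner_sub_left, inner_smul_left, EuclideanSpace.inner_single_left]
    · simp [inner_add_right, inner_sub_left, inner_smul_left, inner_smul_right,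
        EuclideanSpace.inner_single_left, hij, hij.symm]
  have hFc : Continuous (Function.uncurry F) := by
    simp only [F, Function.uncurry_def]; fun_prop
  have hFc' : Continuous (Function.uncurry F') := by
    simp only [F', Function.uncurry_def]; fun_prop
  have hK : IsCompact ((Set.Icc (-1:ℝ) 1) ×ˢ (Set.univ : Set (UnitSphere N))) :=
    isCompact_Icc.prod isCompact_univ
  obtain ⟨B, hB⟩ := hK.exists_bound_of_continuousOn hFc'.continuousOn
  have hd := (hasDerivAt_integral_of_dominated_loc_of_deriv_le (μ := μ) (F := F) (F' := F')
    (x₀ := 0) (s := Set.Icc (-1:ℝ) 1) (bound := fun _ => B)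
    (Icc_mem_nhds (by norm_num) (by norm_num))
    (Filter.Eventually.of_forall fun a =>
      (hFc.comp (Continuous.prodMk_right a)).aestronglyMeasurable)
    (integrable_cont μ (hFc.comp (Continuous.prodMk_right 0)))
    ((hFc'.comp (Continuous.prodMk_right 0)).aestronglyMeasurable)
    (Filter.Eventually.of_forall fun s a ha => hB (a, s) ⟨ha, Set.mem_univ _⟩)
    (integrable_const _)
    (Filter.Eventually.of_forall fun s a ha => by
      have h1 : HasDerivAt (fun a : ℝ => (s : EuclideanSpace ℝ (Fin N)) j -
          a * (s : EuclideanSpace ℝ (Fin N)) i) (- (s : EuclideanSpace ℝ (Fin N)) i) a := by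
        simpa using ((hasDerivAt_id a).mul_const
          ((s : EuclideanSpace ℝ (Fin N)) i)).const_sub ((s : EuclideanSpace ℝ (Fin N)) j)
      have h2 : HasDerivAt (fun a : ℝ => (s : EuclideanSpace ℝ (Fin N)) i +
          a * (s : EuclideanSpace ℝ (Fin N)) j) ((s : EuclideanSpace ℝ (Fin N)) j) a := by
        simpa using ((hasDerivAt_id a).mul_const
          ((s : EuclideanSpace ℝ (Fin N)) j)).const_add ((s : EuclideanSpace ℝ (Fin N)) i)
      exact h1.mul ((hh _).comp a h2))).2
  simp only [hF0] at hd
  have hz := hd.unique (hasDerivAt_const 0 (0:ℝ))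
  have hz2 : ∫ s : UnitSphere N, ((s : EuclideanSpace ℝ (Fin N)) j ^ 2 *
      h' ((s : EuclideanSpace ℝ (Fin N)) i) - (s : EuclideanSpace ℝ (Fin N)) i *
      h ((s : EuclideanSpace ℝ (Fin N)) i)) ∂μ = 0 := by
    rw [← hz]
    congr 1
    ext s
    simp only [F']
    simp
    ring
  rw [integral_sub (integrable_cont μ (by fun_prop)) (integrable_cont μ (by fun_prop))] at hz2
  linarith

lemma sphere_sum_sq {N : ℕ} (s : UnitSphere N) :
    ∑ j, (s : EuclideanSpace ℝ (Fin N)) j ^ 2 = 1 := by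
  have h : ‖(s : EuclideanSpace ℝ (Fin N))‖ = 1 := mem_sphere_zero_iff_norm.mp s.2
  rw [EuclideanSpace.norm_eq, Real.sqrt_eq_one] at h
  simpa using h

lemma sphere_abs_le {N : ℕ} (s : UnitSphere N) (i : Fin N) :
    |(s : EuclideanSpace ℝ (Fin N)) i| ≤ 1 := by
  have h := sphere_sum_sq s
  rw [← sq_le_one_iff_abs_le_one, ← h]
  exact Finset.single_le_sum (f := fun j => (s : EuclideanSpace ℝ (Fin N)) j ^ 2)
    (fun j _ => sq_nonneg _) (Finset.mem_univ i)

lemma stein {N : ℕ} {μ : Measure (UnitSphere N)} [IsProbabilityMeasure μ] (hμ : RotInv μ)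
    (i : Fin N) {h h' : ℝ → ℝ} (hh : ∀ t, HasDerivAt h (h' t) t)
    (hc' : Continuous h') :
    ∫ s : UnitSphere N, (1 - (s : EuclideanSpace ℝ (Fin N)) i ^ 2) *
      h' ((s : EuclideanSpace ℝ (Fin N)) i) ∂μ =
    ((N : ℝ) - 1) * ∫ s : UnitSphere N, (s : EuclideanSpace ℝ (Fin N)) i *
      h ((s : EuclideanSpace ℝ (Fin N)) i) ∂μ := by
  have hc : Continuous h := continuous_iff_continuousAt.2 fun t => (hh t).continuousAt
  have h1 : ∀ s : UnitSphere N, (1 - (s : EuclideanSpace ℝ (Fin N)) i ^ 2) *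
      h' ((s : EuclideanSpace ℝ (Fin N)) i) = ∑ j ∈ Finset.univ.erase i,
        (s : EuclideanSpace ℝ (Fin N)) j ^ 2 * h' ((s : EuclideanSpace ℝ (Fin N)) i) := by
    intro s
    rw [← Finset.sum_mul, ← sphere_sum_sq s, ← Finset.add_sum_erase _ _ (Finset.mem_univ i)]
    ring
  simp_rw [h1]
  rw [integral_finsetSum _ (fun j _ => integrable_cont μ (by fun_prop))]
  rw [Finset.sum_congr rfl (fun j hj => stein_pair hμ i j (Finset.ne_of_mem_erase hj).symm hh hc')]
  rw [Finset.sum_const, Finset.card_erase_of_mem (Finset.mem_univ i), Finset.card_univ,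
    Fintype.card_fin, nsmul_eq_mul, Nat.cast_sub (Nat.one_le_of_lt i.2)]
  simp

lemma sphere_moment_rec {N : ℕ} {μ : Measure (UnitSphere N)} [IsProbabilityMeasure μ]
    (hμ : RotInv μ) (i : Fin N) (j : ℕ) :
    ((N : ℝ) - 1 + (j + 1)) * ∫ s : UnitSphere N, (s : EuclideanSpace ℝ (Fin N)) i ^ (j + 2) ∂μ =
    (j + 1) * ∫ s : UnitSphere N, (s : EuclideanSpace ℝ (Fin N)) i ^ j ∂μ := by
  have h := stein hμ i (h := fun t => t ^ (j + 1)) (h' := fun t => ((j:ℝ) + 1) * t ^ j)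
    (fun t => by simpa using hasDerivAt_pow (j + 1) t) (by fun_prop)
  have h1 : ∫ s : UnitSphere N, (1 - (s : EuclideanSpace ℝ (Fin N)) i ^ 2) *
      (((j:ℝ) + 1) * (s : EuclideanSpace ℝ (Fin N)) i ^ j) ∂μ =
      (j + 1) * ∫ s : UnitSphere N, (s : EuclideanSpace ℝ (Fin N)) i ^ j ∂μ -
      (j + 1) * ∫ s : UnitSphere N, (s : EuclideanSpace ℝ (Fin N)) i ^ (j + 2) ∂μ := by
    rw [← integral_const_mul, ← integral_const_mul, ← integral_sub
      (integrable_cont μ (by fun_prop)) (integrable_cont μ (by fun_prop))]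
    congr 1; ext s; ring
  have h2 : ∫ s : UnitSphere N, (s : EuclideanSpace ℝ (Fin N)) i *
      (s : EuclideanSpace ℝ (Fin N)) i ^ (j + 1) ∂μ =
      ∫ s : UnitSphere N, (s : EuclideanSpace ℝ (Fin N)) i ^ (j + 2) ∂μ := by
    congr 1; ext s; ring
  rw [h1] at h
  simp only [h2] at h
  linarith

lemma sphere_moment_one {N : ℕ} {μ : Measure (UnitSphere N)} [IsProbabilityMeasure μ]
    (hμ : RotInv μ) (i : Fin N) :
    ∫ s : UnitSphere N, (s : EuclideanSpace ℝ (Fin N)) i ∂μ = 0 := by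
  have := integral_odd hμ 0 (EuclideanSpace.single i (1:ℝ)) (by simp) (h := fun _ => 1)
    continuous_const
  simpa [EuclideanSpace.inner_single_left] using this

lemma sin_moment_rec (N : ℕ) (hN : 2 ≤ N) (j : ℕ) :
    ((N : ℝ) - 1 + (j + 1)) * ∫ θ in (0:ℝ)..π, Real.cos θ ^ (j + 2) * Real.sin θ ^ (N - 2) =
    (j + 1) * ∫ θ in (0:ℝ)..π, Real.cos θ ^ j * Real.sin θ ^ (N - 2) := by
  obtain ⟨M, rfl⟩ : ∃ M, N = M + 2 := ⟨N - 2, by omega⟩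
  simp only [Nat.add_sub_cancel]
  have hd : ∀ θ ∈ Set.uIcc 0 π, HasDerivAt (fun θ => Real.sin θ ^ (M + 1) * Real.cos θ ^ (j + 1))
      (((M:ℝ) + 1 + (j + 1)) * (Real.cos θ ^ (j + 2) * Real.sin θ ^ M) -
        (j + 1) * (Real.cos θ ^ j * Real.sin θ ^ M)) θ := by
    intro θ _
    convert! ((Real.hasDerivAt_sin θ).pow (M + 1)).mul ((Real.hasDerivAt_cos θ).pow (j + 1)) using 1
    have := Real.sin_sq_add_cos_sq θ
    push_cast
    have e : Real.sin θ ^ 2 = 1 - Real.cos θ ^ 2 := by linarith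
    have e2 : Real.sin θ ^ (M + 1) * (((j:ℝ) + 1) * Real.cos θ ^ j * -Real.sin θ) =
      - ((j:ℝ) + 1) * Real.cos θ ^ j * (Real.sin θ ^ M * Real.sin θ ^ 2) := by ring
    simp only [Pi.pow_apply]
    rw [e2, e]
    ring
  have h := intervalIntegral.integral_eq_sub_of_hasDerivAt hd
    (Continuous.intervalIntegrable (by fun_prop) _ _)
  rw [intervalIntegral.integral_sub (Continuous.intervalIntegrable (by fun_prop) _ _)
    (Continuous.intervalIntegrable (by fun_prop) _ _), intervalIntegral.integral_const_mul,
    intervalIntegral.integral_const_mul] at h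
  simp at h
  push_cast
  linarith

lemma sin_moment_one (N : ℕ) :
    ∫ θ in (0:ℝ)..π, Real.cos θ ^ 1 * Real.sin θ ^ (N - 2) = 0 := by
  set M := N - 2
  have hd : ∀ θ ∈ Set.uIcc 0 π, HasDerivAt (fun θ => Real.sin θ ^ (M + 1))
      (((M:ℝ) + 1) * (Real.cos θ ^ 1 * Real.sin θ ^ M)) θ := by
    intro θ _
    convert! ((Real.hasDerivAt_sin θ).pow (M + 1)) using 1
    push_cast
    ring
  have h := intervalIntegral.integral_eq_sub_of_hasDerivAt hd
    (Continuous.intervalIntegrable (by fun_prop) _ _)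
  rw [intervalIntegral.integral_const_mul] at h
  simp at h
  have : (M:ℝ) + 1 ≠ 0 := by positivity
  simpa using h.resolve_left this

lemma moment_match {N : ℕ} (hN : 2 ≤ N) {μ : Measure (UnitSphere N)} [IsProbabilityMeasure μ]
    (hμ : RotInv μ) (i : Fin N) (j : ℕ) :
    ∫ θ in (0:ℝ)..π, Real.cos θ ^ j * Real.sin θ ^ (N - 2) =
      (∫ θ in (0:ℝ)..π, Real.sin θ ^ (N - 2)) *
        ∫ s : UnitSphere N, (s : EuclideanSpace ℝ (Fin N)) i ^ j ∂μ := by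
  induction j using Nat.strong_induction_on with
  | _ j ih =>
    match j with
    | 0 => simp
    | 1 =>
      rw [sin_moment_one]
      simp [sphere_moment_one hμ i]
    | j + 2 =>
      have h0 := ih j (by omega)
      have h1 := sphere_moment_rec hμ i j
      have h2 := sin_moment_rec N hN j
      have hN' : (2:ℝ) ≤ N := by exact_mod_cast hN
      have hne : (N : ℝ) - 1 + (j + 1) ≠ 0 := by
        have : (0:ℝ) ≤ j := Nat.cast_nonneg j
        linarith
      apply mul_left_cancel₀ hne
      rw [h2, h0]
      linear_combination (-(∫ θ in (0:ℝ)..π, Real.sin θ ^ (N - 2))) * h1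

lemma poly_match {N : ℕ} (hN : 2 ≤ N) {μ : Measure (UnitSphere N)} [IsProbabilityMeasure μ]
    (hμ : RotInv μ) (i : Fin N) (p : Polynomial ℝ) :
    ∫ θ in (0:ℝ)..π, p.eval (Real.cos θ) * Real.sin θ ^ (N - 2) =
      (∫ θ in (0:ℝ)..π, Real.sin θ ^ (N - 2)) *
        ∫ s : UnitSphere N, p.eval ((s : EuclideanSpace ℝ (Fin N)) i) ∂μ := by
  induction p using Polynomial.induction_on' with
  | add p q hp hq =>
    simp only [Polynomial.eval_add, add_mul]
    rw [intervalIntegral.integral_add (Continuous.intervalIntegrable (by fun_prop) _ _)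
      (Continuous.intervalIntegrable (by fun_prop) _ _),
      integral_add (integrable_cont μ (by fun_prop)) (integrable_cont μ (by fun_prop)), hp, hq]
    ring
  | monomial n a =>
    simp only [Polynomial.eval_monomial, mul_assoc]
    rw [intervalIntegral.integral_const_mul, integral_const_mul, moment_match hN hμ i n]
    ring

lemma cont_match {N : ℕ} (hN : 2 ≤ N) {μ : Measure (UnitSphere N)} [IsProbabilityMeasure μ]
    (hμ : RotInv μ) (i : Fin N) {h : ℝ → ℝ} (hh : Continuous h) :
    ∫ θ in (0:ℝ)..π, h (Real.cos θ) * Real.sin θ ^ (N - 2) =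
      (∫ θ in (0:ℝ)..π, Real.sin θ ^ (N - 2)) *
        ∫ s : UnitSphere N, h ((s : EuclideanSpace ℝ (Fin N)) i) ∂μ := by
  set c := ∫ θ in (0:ℝ)..π, Real.sin θ ^ (N - 2) with hcdef
  have hc : 0 < c := integral_sin_pow_pos _
  apply eq_of_forall_dist_le
  intro ε hε
  rw [Real.dist_eq]
  obtain ⟨p, hp⟩ := exists_polynomial_near_of_continuousOn (-1) 1 h hh.continuousOn
    (ε / (2 * c)) (by positivity)
  have hpm := poly_match hN hμ i p
  rw [← hcdef] at hpm
  have h1 : |(∫ θ in (0:ℝ)..π, h (Real.cos θ) * Real.sin θ ^ (N - 2)) -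
      ∫ θ in (0:ℝ)..π, p.eval (Real.cos θ) * Real.sin θ ^ (N - 2)| ≤ ε / 2 := by
    rw [← intervalIntegral.integral_sub (Continuous.intervalIntegrable (by fun_prop) _ _)
      (Continuous.intervalIntegrable (by fun_prop) _ _)]
    calc _ ≤ ∫ θ in (0:ℝ)..π, |h (Real.cos θ) * Real.sin θ ^ (N - 2) -
            p.eval (Real.cos θ) * Real.sin θ ^ (N - 2)| :=
          intervalIntegral.abs_integral_le_integral_abs pi_pos.le
      _ ≤ ∫ θ in (0:ℝ)..π, ε / (2 * c) * Real.sin θ ^ (N - 2) := by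
          apply intervalIntegral.integral_mono_on pi_pos.le
            (Continuous.intervalIntegrable (by fun_prop) _ _)
            (Continuous.intervalIntegrable (by fun_prop) _ _)
          intro θ hθ
          have hs : 0 ≤ Real.sin θ ^ (N - 2) := pow_nonneg (Real.sin_nonneg_of_mem_Icc hθ) _
          rw [← sub_mul, abs_mul, abs_of_nonneg hs]
          apply mul_le_mul_of_nonneg_right _ hs
          rw [abs_sub_comm]
          exact (hp _ ⟨Real.neg_one_le_cos θ, Real.cos_le_one θ⟩).le
      _ = ε / 2 := by
          rw [intervalIntegral.integral_const_mul, ← hcdef]; field_simp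
  have h2 : |(∫ s : UnitSphere N, h ((s : EuclideanSpace ℝ (Fin N)) i) ∂μ) -
      ∫ s : UnitSphere N, p.eval ((s : EuclideanSpace ℝ (Fin N)) i) ∂μ| ≤ ε / (2 * c) := by
    rw [← integral_sub (integrable_cont μ (by fun_prop)) (integrable_cont μ (by fun_prop))]
    have := norm_integral_le_of_norm_le_const (μ := μ)
      (f := fun s : UnitSphere N => h ((s : EuclideanSpace ℝ (Fin N)) i) -
        p.eval ((s : EuclideanSpace ℝ (Fin N)) i)) (C := ε / (2 * c))
      (Filter.Eventually.of_forall fun s => by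
        rw [Real.norm_eq_abs, abs_sub_comm]
        exact (hp _ (abs_le.1 (sphere_abs_le s i))).le)
    simpa using this
  have h3 : |c * (∫ s : UnitSphere N, h ((s : EuclideanSpace ℝ (Fin N)) i) ∂μ) -
      c * ∫ s : UnitSphere N, p.eval ((s : EuclideanSpace ℝ (Fin N)) i) ∂μ| ≤ ε / 2 := by
    rw [← mul_sub, abs_mul, abs_of_pos hc]
    calc _ ≤ c * (ε / (2 * c)) := by gcongr
      _ = ε / 2 := by field_simp
  rw [hpm] at h1
  rw [abs_le] at *
  constructor <;> linarith [h1.1, h1.2, h3.1, h3.2]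

/-- Exponential moments of a coordinate. -/
noncomputable def Mom {N : ℕ} (μ : Measure (UnitSphere N)) (i : Fin N) (j : ℕ) (r : ℝ) : ℝ :=
  ∫ s : UnitSphere N, (s : EuclideanSpace ℝ (Fin N)) i ^ j *
    Real.exp (r * (s : EuclideanSpace ℝ (Fin N)) i) ∂μ

lemma hasDerivAt_Mom {N : ℕ} (μ : Measure (UnitSphere N)) [IsProbabilityMeasure μ] (i : Fin N)
    (j : ℕ) (r : ℝ) : HasDerivAt (Mom μ i j) (Mom μ i (j + 1) r) r := by
  apply ProbabilityTheory.hasDerivAt_integral_pow_mul_exp_real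
  have : ProbabilityTheory.integrableExpSet
      (fun s : UnitSphere N => (s : EuclideanSpace ℝ (Fin N)) i) μ = Set.univ := by
    ext t
    simp only [ProbabilityTheory.integrableExpSet, Set.mem_ofPred_eq, Set.mem_univ, iff_true]
    exact integrable_cont μ (by fun_prop)
  rw [this]
  simp

lemma Mom_zero_pos {N : ℕ} (μ : Measure (UnitSphere N)) [IsProbabilityMeasure μ] (i : Fin N)
    (r : ℝ) : 0 < Mom μ i 0 r := by
  unfold Mom
  simp only [pow_zero, one_mul]
  exact integral_exp_pos (integrable_cont μ (by fun_prop))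

/-- The function `k(r) = f(r)/r`. -/
noncomputable def kfun {N : ℕ} (μ : Measure (UnitSphere N)) (i : Fin N) (r : ℝ) : ℝ :=
  (1 - Mom μ i 2 r / Mom μ i 0 r) / ((N : ℝ) - 1)

lemma Mom_one {N : ℕ} (hN : 2 ≤ N) {μ : Measure (UnitSphere N)} [IsProbabilityMeasure μ]
    (hμ : RotInv μ) (i : Fin N) (r : ℝ) :
    Mom μ i 1 r = r * kfun μ i r * Mom μ i 0 r := by
  have h := stein hμ i (h := fun t => Real.exp (r * t)) (h' := fun t => r * Real.exp (r * t))
    (fun t => by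
      have := ((hasDerivAt_id t).const_mul r).exp
      simpa [mul_comm] using this) (by fun_prop)
  have h1 : ∫ s : UnitSphere N, (1 - (s : EuclideanSpace ℝ (Fin N)) i ^ 2) *
      (r * Real.exp (r * (s : EuclideanSpace ℝ (Fin N)) i)) ∂μ =
      r * (Mom μ i 0 r - Mom μ i 2 r) := by
    unfold Mom
    rw [← integral_sub (integrable_cont μ (by fun_prop)) (integrable_cont μ (by fun_prop)),
      ← integral_const_mul]
    congr 1; ext s; ring
  rw [h1] at h
  have h2 : ∫ s : UnitSphere N, (s : EuclideanSpace ℝ (Fin N)) i *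
      Real.exp (r * (s : EuclideanSpace ℝ (Fin N)) i) ∂μ = Mom μ i 1 r := by
    unfold Mom; simp
  rw [h2] at h
  have h0 := (Mom_zero_pos μ i r).ne'
  have hN' : (2:ℝ) ≤ N := by exact_mod_cast hN
  have hN1 : (N : ℝ) - 1 ≠ 0 := by linarith
  unfold kfun
  field_simp
  linarith

lemma besselRatio_eq {N : ℕ} (hN : 2 ≤ N) {μ : Measure (UnitSphere N)} [IsProbabilityMeasure μ]
    (hμ : RotInv μ) (i : Fin N) (r : ℝ) : besselRatio N r = r * kfun μ i r := by
  have h0 := cont_match hN hμ i (h := fun t => Real.exp (r * t)) (by fun_prop)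
  have h2 := cont_match hN hμ i (h := fun t => (1 - t ^ 2) * Real.exp (r * t)) (by fun_prop)
  have hc : 0 < ∫ θ in (0:ℝ)..π, Real.sin θ ^ (N - 2) := integral_sin_pow_pos _
  have e : ∀ θ : ℝ, Real.exp (r * Real.cos θ) * Real.sin θ ^ N =
      (1 - Real.cos θ ^ 2) * Real.exp (r * Real.cos θ) * Real.sin θ ^ (N - 2) := by
    intro θ
    obtain ⟨M, rfl⟩ : ∃ M, N = M + 2 := ⟨N - 2, by omega⟩
    rw [← Real.sin_sq]
    simp only [Nat.add_sub_cancel]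
    ring
  have h3 : ∫ s : UnitSphere N, (1 - (s : EuclideanSpace ℝ (Fin N)) i ^ 2) *
      Real.exp (r * (s : EuclideanSpace ℝ (Fin N)) i) ∂μ =
      Mom μ i 0 r - Mom μ i 2 r := by
    unfold Mom
    rw [← integral_sub (integrable_cont μ (by fun_prop)) (integrable_cont μ (by fun_prop))]
    congr 1; ext s; ring
  have h4 : ∫ s : UnitSphere N, Real.exp (r * (s : EuclideanSpace ℝ (Fin N)) i) ∂μ =
      Mom μ i 0 r := by
    unfold Mom; simp
  have hm0 := (Mom_zero_pos μ i r).ne'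
  have hN' : (2:ℝ) ≤ N := by exact_mod_cast hN
  have hN1 : (N : ℝ) - 1 ≠ 0 := by linarith
  unfold besselRatio kfun
  simp_rw [e]
  rw [h0, h2, h3, h4]
  field_simp

lemma Mom_neg {N : ℕ} {μ : Measure (UnitSphere N)} [IsProbabilityMeasure μ]
    (hμ : RotInv μ) (i : Fin N) (j : ℕ) (r : ℝ) :
    Mom μ i j (-r) = (-1) ^ j * Mom μ i j r := by
  have h := integral_transport hμ (EuclideanSpace.single i (1:ℝ))
    (-EuclideanSpace.single i (1:ℝ)) (norm_neg _).symm
    (h := fun t => t ^ j * Real.exp (r * t)) (by fun_prop)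
  simp only [inner_neg_left, EuclideanSpace.inner_single_left, map_one, one_mul] at h
  unfold Mom
  rw [h, ← integral_const_mul]
  congr 1
  ext s
  rw [neg_pow ((s : EuclideanSpace ℝ (Fin N)) i), ← mul_assoc, ← mul_assoc, ← mul_pow]
  simp

lemma prod_expand {N : ℕ} (μ : Measure (UnitSphere N)) [IsProbabilityMeasure μ]
    (i : Fin N) (r : ℝ) :
    ∫ z : UnitSphere N × UnitSphere N,
      ((z.1 : EuclideanSpace ℝ (Fin N)) i - (z.2 : EuclideanSpace ℝ (Fin N)) i) ^ 2 *
      ((z.1 : EuclideanSpace ℝ (Fin N)) i + (z.2 : EuclideanSpace ℝ (Fin N)) i) *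
      Real.exp (r * ((z.1 : EuclideanSpace ℝ (Fin N)) i + (z.2 : EuclideanSpace ℝ (Fin N)) i))
      ∂(μ.prod μ) = 2 * (Mom μ i 3 r * Mom μ i 0 r - Mom μ i 2 r * Mom μ i 1 r) := by
  have hp : ∀ j k : ℕ, Mom μ i j r * Mom μ i k r = ∫ z : UnitSphere N × UnitSphere N,
      ((z.1 : EuclideanSpace ℝ (Fin N)) i ^ j *
        Real.exp (r * (z.1 : EuclideanSpace ℝ (Fin N)) i)) *
      ((z.2 : EuclideanSpace ℝ (Fin N)) i ^ k *
        Real.exp (r * (z.2 : EuclideanSpace ℝ (Fin N)) i)) ∂(μ.prod μ) := by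
    intro j k
    unfold Mom
    rw [← integral_prod_mul]
  have e : 2 * (Mom μ i 3 r * Mom μ i 0 r - Mom μ i 2 r * Mom μ i 1 r) =
      Mom μ i 3 r * Mom μ i 0 r - Mom μ i 2 r * Mom μ i 1 r -
      Mom μ i 1 r * Mom μ i 2 r + Mom μ i 0 r * Mom μ i 3 r := by ring
  rw [e, hp, hp, hp, hp, ← integral_sub (integrable_cont _ (by fun_prop))
    (integrable_cont _ (by fun_prop)), ← integral_sub (integrable_cont _ (by fun_prop))
    (integrable_cont _ (by fun_prop)), ← integral_add (integrable_cont _ (by fun_prop))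
    (integrable_cont _ (by fun_prop))]
  congr 1
  ext z
  rw [mul_add r, Real.exp_add]
  ring

lemma mul_exp_sub_nonneg {r : ℝ} (hr : 0 < r) (x : ℝ) :
    0 ≤ x * (Real.exp (r * x) - Real.exp (-r * x)) ∧
    (x * (Real.exp (r * x) - Real.exp (-r * x)) = 0 → x = 0) := by
  rcases lt_trichotomy x 0 with h | h | h
  · have h1 : Real.exp (r * x) < Real.exp (-r * x) := by
      apply Real.exp_lt_exp.2; nlinarith
    have : 0 < x * (Real.exp (r * x) - Real.exp (-r * x)) :=
      mul_pos_of_neg_of_neg h (by linarith)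
    exact ⟨this.le, fun h' => absurd h' this.ne'⟩
  · subst h; simp
  · have h1 : Real.exp (-r * x) < Real.exp (r * x) := by
      apply Real.exp_lt_exp.2; nlinarith
    have : 0 < x * (Real.exp (r * x) - Real.exp (-r * x)) :=
      mul_pos h (by linarith)
    exact ⟨this.le, fun h' => absurd h' this.ne'⟩

/-- Positivity of the covariance of `t` and `t²` under the tilted measure. -/
lemma cov_pos {N : ℕ} (hN : 2 ≤ N) {μ : Measure (UnitSphere N)} [IsProbabilityMeasure μ]
    (hμ : RotInv μ) (i : Fin N) {r : ℝ} (hr : 0 < r) :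
    0 < Mom μ i 3 r * Mom μ i 0 r - Mom μ i 2 r * Mom μ i 1 r := by
  have h1 := prod_expand μ i r
  have h2 := prod_expand μ i (-r)
  simp only [Mom_neg hμ] at h2
  set D := Mom μ i 3 r * Mom μ i 0 r - Mom μ i 2 r * Mom μ i 1 r with hD
  let F : UnitSphere N × UnitSphere N → ℝ := fun z =>
      ((z.1 : EuclideanSpace ℝ (Fin N)) i - (z.2 : EuclideanSpace ℝ (Fin N)) i) ^ 2 *
      (((z.1 : EuclideanSpace ℝ (Fin N)) i + (z.2 : EuclideanSpace ℝ (Fin N)) i) *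
      (Real.exp (r * ((z.1 : EuclideanSpace ℝ (Fin N)) i + (z.2 : EuclideanSpace ℝ (Fin N)) i)) -
      Real.exp (-r * ((z.1 : EuclideanSpace ℝ (Fin N)) i + (z.2 : EuclideanSpace ℝ (Fin N)) i))))
  have hF0 : 0 ≤ F := fun z => mul_nonneg (sq_nonneg _) (mul_exp_sub_nonneg hr _).1
  have hFc : Continuous F := by simp only [F]; fun_prop
  have hFi := integrable_cont (μ.prod μ) hFc
  have hFD : ∫ z, F z ∂(μ.prod μ) = 4 * D := by
    have : 4 * D = 2 * D - 2 * ((-1) ^ 3 * Mom μ i 3 r * ((-1) ^ 0 * Mom μ i 0 r) -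
      (-1) ^ 2 * Mom μ i 2 r * ((-1) ^ 1 * Mom μ i 1 r)) := by rw [hD]; ring
    rw [this, ← h1, ← h2, ← integral_sub (integrable_cont _ (by fun_prop))
      (integrable_cont _ (by fun_prop))]
    congr 1
    ext z
    simp only [F]
    ring
  have hge : 0 ≤ ∫ z, F z ∂(μ.prod μ) := integral_nonneg hF0
  rcases hge.lt_or_eq with hlt | heq
  · linarith
  exfalso
  have hae := (integral_eq_zero_iff_of_nonneg hF0 hFi).1 heq.symm
  have hz : ∫ z : UnitSphere N × UnitSphere N, ((z.1 : EuclideanSpace ℝ (Fin N)) i ^ 2 -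
      (z.2 : EuclideanSpace ℝ (Fin N)) i ^ 2) ^ 2 ∂(μ.prod μ) = 0 := by
    apply integral_eq_zero_of_ae
    filter_upwards [hae] with z hz
    simp only [F, Pi.zero_apply, mul_eq_zero] at hz
    simp only [Pi.zero_apply]
    rcases hz with hz | hz
    · have := pow_eq_zero_iff (two_ne_zero) |>.1 hz
      rw [sq_sub_sq, this]; ring
    · have := (mul_exp_sub_nonneg hr _).2 (mul_eq_zero.2 hz)
      rw [sq_sub_sq, this]; ring
  have hp : ∀ j k : ℕ, (∫ s : UnitSphere N, (s : EuclideanSpace ℝ (Fin N)) i ^ j ∂μ) *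
      (∫ s : UnitSphere N, (s : EuclideanSpace ℝ (Fin N)) i ^ k ∂μ) =
      ∫ z : UnitSphere N × UnitSphere N, (z.1 : EuclideanSpace ℝ (Fin N)) i ^ j *
      (z.2 : EuclideanSpace ℝ (Fin N)) i ^ k ∂(μ.prod μ) := by
    intro j k
    rw [← integral_prod_mul]
  have e : ∫ z : UnitSphere N × UnitSphere N, ((z.1 : EuclideanSpace ℝ (Fin N)) i ^ 2 -
      (z.2 : EuclideanSpace ℝ (Fin N)) i ^ 2) ^ 2 ∂(μ.prod μ) =
      (∫ s : UnitSphere N, (s : EuclideanSpace ℝ (Fin N)) i ^ 4 ∂μ) *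
      (∫ s : UnitSphere N, (s : EuclideanSpace ℝ (Fin N)) i ^ 0 ∂μ) - 2 *
      ((∫ s : UnitSphere N, (s : EuclideanSpace ℝ (Fin N)) i ^ 2 ∂μ) *
      (∫ s : UnitSphere N, (s : EuclideanSpace ℝ (Fin N)) i ^ 2 ∂μ)) +
      (∫ s : UnitSphere N, (s : EuclideanSpace ℝ (Fin N)) i ^ 0 ∂μ) *
      (∫ s : UnitSphere N, (s : EuclideanSpace ℝ (Fin N)) i ^ 4 ∂μ) := by
    rw [hp, hp, hp, ← integral_const_mul, ← integral_sub (integrable_cont _ (by fun_prop))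
      (integrable_cont _ (by fun_prop)), ← integral_add (integrable_cont _ (by fun_prop))
      (integrable_cont _ (by fun_prop))]
    congr 1
    ext z
    ring
  rw [hz] at e
  have r0 := sphere_moment_rec hμ i 0
  have r2 := sphere_moment_rec hμ i 2
  norm_num at r0 r2 e
  set m2 := ∫ s : UnitSphere N, (s : EuclideanSpace ℝ (Fin N)) i ^ 2 ∂μ
  set m4 := ∫ s : UnitSphere N, (s : EuclideanSpace ℝ (Fin N)) i ^ 4 ∂μ
  have hN' : (2:ℝ) ≤ N := by exact_mod_cast hN
  have hm2 : 0 < m2 := by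
    by_contra! hneg
    nlinarith
  have e' : m4 = m2 * m2 := by linarith
  rw [e'] at r2
  have : ((N:ℝ) - 1 + 3) * m2 = 3 := by
    have := mul_right_cancel₀ hm2.ne' (show (((N:ℝ) - 1 + 3) * m2) * m2 = 3 * m2 by linarith)
    exact this
  nlinarith

lemma hasDerivAt_kfun {N : ℕ} (μ : Measure (UnitSphere N)) [IsProbabilityMeasure μ]
    (i : Fin N) (r : ℝ) : HasDerivAt (kfun μ i)
      (-((Mom μ i 3 r * Mom μ i 0 r - Mom μ i 2 r * Mom μ i 1 r) / Mom μ i 0 r ^ 2) /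
        ((N : ℝ) - 1)) r := by
  have := (((hasDerivAt_Mom μ i 2 r).div (hasDerivAt_Mom μ i 0 r)
    (Mom_zero_pos μ i r).ne').const_sub 1).div_const ((N : ℝ) - 1)
  exact this

lemma continuous_Mom {N : ℕ} (μ : Measure (UnitSphere N)) [IsProbabilityMeasure μ]
    (i : Fin N) (j : ℕ) : Continuous (Mom μ i j) :=
  continuous_iff_continuousAt.2 fun r => (hasDerivAt_Mom μ i j r).continuousAt

lemma contDiff_kfun {N : ℕ} (μ : Measure (UnitSphere N)) [IsProbabilityMeasure μ]
    (i : Fin N) : ContDiff ℝ 1 (kfun μ i) := by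
  rw [contDiff_one_iff_deriv]
  refine ⟨fun r => (hasDerivAt_kfun μ i r).differentiableAt, ?_⟩
  have : deriv (kfun μ i) = fun r =>
      (-((Mom μ i 3 r * Mom μ i 0 r - Mom μ i 2 r * Mom μ i 1 r) / Mom μ i 0 r ^ 2) /
        ((N : ℝ) - 1)) := by
    ext r; exact (hasDerivAt_kfun μ i r).deriv
  rw [this]
  have h0 := continuous_Mom μ i 0
  have h1 := continuous_Mom μ i 1
  have h2 := continuous_Mom μ i 2
  have h3 := continuous_Mom μ i 3
  have : ∀ r, Mom μ i 0 r ^ 2 ≠ 0 := fun r => pow_ne_zero _ (Mom_zero_pos μ i r).ne'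
  fun_prop (disch := assumption)

lemma deriv_kfun_neg {N : ℕ} (hN : 2 ≤ N) {μ : Measure (UnitSphere N)} [IsProbabilityMeasure μ]
    (hμ : RotInv μ) (i : Fin N) {r : ℝ} (hr : 0 < r) : deriv (kfun μ i) r < 0 := by
  rw [(hasDerivAt_kfun μ i r).deriv]
  have h := cov_pos hN hμ i hr
  have h0 := Mom_zero_pos μ i r
  have hN' : (2:ℝ) ≤ N := by exact_mod_cast hN
  have hN1 : 0 < (N : ℝ) - 1 := by linarith
  rw [neg_div, neg_lt_zero]
  positivity

lemma kfun_strictAnti {N : ℕ} (hN : 2 ≤ N) {μ : Measure (UnitSphere N)} [IsProbabilityMeasure μ]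
    (hμ : RotInv μ) (i : Fin N) : StrictAntiOn (kfun μ i) (Set.Ici 0) := by
  apply strictAntiOn_of_deriv_neg (convex_Ici 0) (contDiff_kfun μ i).continuous.continuousOn
  intro r hr
  rw [interior_Ici] at hr
  exact deriv_kfun_neg hN hμ i hr

lemma free_energy_pos {N : ℕ} (hN : 2 ≤ N) {μ : Measure (UnitSphere N)} [IsProbabilityMeasure μ]
    (hμ : RotInv μ) (i : Fin N) {β b : ℝ} (hβ : 0 < β) (hb : 0 < b) (hk : β * kfun μ i b = 1) :
    b ^ 2 / (2 * β) < Real.log (Mom μ i 0 b) := by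
  have hd : ∀ x, HasDerivAt (fun x => Real.log (Mom μ i 0 x) - x ^ 2 / (2 * β))
      (x * (kfun μ i x - kfun μ i b)) x := by
    intro x
    have h0 := (Mom_zero_pos μ i x).ne'
    have h1 := ((hasDerivAt_Mom μ i 0 x).log h0).sub ((hasDerivAt_pow 2 x).div_const (2 * β))
    convert! h1 using 1
    rw [zero_add, Mom_one hN hμ i x]
    have : kfun μ i b = 1 / β := by field_simp; linarith
    rw [this]
    field_simp
    simp
    ring
  have hmono : StrictMonoOn (fun x => Real.log (Mom μ i 0 x) - x ^ 2 / (2 * β)) (Set.Icc 0 b) := by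
    apply strictMonoOn_of_deriv_pos (convex_Icc 0 b)
    · exact fun x _ => (hd x).continuousAt.continuousWithinAt
    · intro x hx
      rw [interior_Icc] at hx
      rw [(hd x).deriv]
      have := kfun_strictAnti hN hμ i (Set.mem_Ici.2 hx.1.le) (Set.mem_Ici.2 hb.le) hx.2
      exact mul_pos hx.1 (by linarith)
  have h := hmono (Set.left_mem_Icc.2 hb.le) (Set.right_mem_Icc.2 hb.le) hb
  have h00 : Mom μ i 0 0 = 1 := by simp [Mom]
  simp only [h00] at h
  simp at h
  linarith

lemma quad_lower {N : ℕ} (hN : 2 ≤ N) {μ : Measure (UnitSphere N)} [IsProbabilityMeasure μ]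
    (hμ : RotInv μ) (i : Fin N) {β b : ℝ} (hβ : 0 < β) (hb : 0 < b) (hk : β * kfun μ i b = 1) :
    ∃ c > 0, ∀ r ∈ Set.Icc 0 β,
      c * (r - b) ^ 2 ≤ (r ^ 2 - b ^ 2) * (1 - β * kfun μ i r) := by
  have hdiff := (contDiff_kfun μ i).differentiable (by norm_num)
  have hcont : Continuous (dslope (kfun μ i) b) := by
    rw [← continuousOn_univ, continuousOn_dslope Filter.univ_mem]
    exact ⟨(contDiff_kfun μ i).continuous.continuousOn, hdiff b⟩
  obtain ⟨r0, hr0, hmax⟩ := isCompact_Icc.exists_isMaxOn (Set.nonempty_Icc.2 hβ.le)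
    hcont.continuousOn
  have hanti := kfun_strictAnti hN hμ i
  have hneg : ∀ r ∈ Set.Icc 0 β, dslope (kfun μ i) b r < 0 := by
    intro r hr
    by_cases hrb : r = b
    · subst hrb
      rw [dslope_same]
      exact deriv_kfun_neg hN hμ i hb
    · rw [dslope_of_ne _ hrb, slope_def_field]
      rcases lt_or_gt_of_ne hrb with h | h
      · exact div_neg_of_pos_of_neg
          (by linarith [hanti (Set.mem_Ici.2 hr.1) (Set.mem_Ici.2 hb.le) h]) (by linarith)
      · exact div_neg_of_neg_of_pos
          (by linarith [hanti (Set.mem_Ici.2 hb.le) (Set.mem_Ici.2 hr.1) h]) (by linarith)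
  refine ⟨b * β * (- dslope (kfun μ i) b r0), ?_, fun r hr => ?_⟩
  · have := hneg r0 hr0
    have : 0 < - dslope (kfun μ i) b r0 := by linarith
    positivity
  · have h1 := sub_smul_dslope (kfun μ i) b r
    rw [smul_eq_mul] at h1
    have h2 : dslope (kfun μ i) b r ≤ dslope (kfun μ i) b r0 := hmax hr
    have h3 := hneg r hr
    set d := dslope (kfun μ i) b r
    have e : (r ^ 2 - b ^ 2) * (1 - β * kfun μ i r) = (r + b) * β * (-d) * (r - b) ^ 2 := by
      rw [← hk]
      have : kfun μ i r = kfun μ i b + (r - b) * d := by linarith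
      rw [this]; ring
    rw [e]
    apply mul_le_mul_of_nonneg_right _ (sq_nonneg _)
    apply mul_le_mul
    · nlinarith [hr.1]
    · linarith
    · linarith [hneg r0 hr0]
    · have := hr.1; positivity

lemma G_lip {N : ℕ} (μ : Measure (UnitSphere N)) [IsProbabilityMeasure μ]
    (i : Fin N) (b R : ℝ) :
    ∃ K : ℝ, 0 ≤ K ∧ ∀ x ∈ Set.Icc 0 R, ∀ y ∈ Set.Icc 0 R,
      |(x ^ 2 - b ^ 2) * (kfun μ i x * x ^ 2) - (y ^ 2 - b ^ 2) * (kfun μ i y * y ^ 2)|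
        ≤ K * |x - y| := by
  have hc : ContDiff ℝ 1 (fun x => (x ^ 2 - b ^ 2) * (kfun μ i x * x ^ 2)) := by
    have := contDiff_kfun μ i
    fun_prop
  obtain ⟨K, hK⟩ := (hc.locallyLipschitz.locallyLipschitzOn
    (s := Set.Icc 0 R)).exists_lipschitzOnWith_of_compact isCompact_Icc
  refine ⟨K, K.2, fun x hx y hy => ?_⟩
  have := hK.dist_le_mul x hx y hy
  simpa [Real.dist_eq] using this

lemma Psi_lip {N : ℕ} (μ : Measure (UnitSphere N)) [IsProbabilityMeasure μ]
    (i : Fin N) (b R : ℝ) :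
    ∃ K : ℝ, 0 ≤ K ∧ ∀ (x y s : EuclideanSpace ℝ (Fin N)), ‖x‖ ≤ R → ‖y‖ ≤ R → ‖s‖ = 1 →
      (‖x‖ ^ 2 - b ^ 2) * (⟪x, s⟫ - kfun μ i ‖x‖ * ‖x‖ ^ 2) ≤
      (‖y‖ ^ 2 - b ^ 2) * (⟪y, s⟫ - kfun μ i ‖y‖ * ‖y‖ ^ 2) + K * ‖x - y‖ := by
  obtain ⟨K, hK0, hK⟩ := G_lip μ i b R
  refine ⟨R ^ 2 + b ^ 2 + 2 * R * R + K, ?_, fun x y s hx hy hs => ?_⟩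
  · nlinarith [sq_nonneg R, sq_nonneg b]
  have hx0 := norm_nonneg x
  have hy0 := norm_nonneg y
  have hR : 0 ≤ R := hx0.trans hx
  have hxy : |‖x‖ - ‖y‖| ≤ ‖x - y‖ := abs_norm_sub_norm_le x y
  have h1 := hK ‖x‖ ⟨hx0, hx⟩ ‖y‖ ⟨hy0, hy⟩
  have h1' : K * |‖x‖ - ‖y‖| ≤ K * ‖x - y‖ := mul_le_mul_of_nonneg_left hxy hK0
  have h2 : |⟪x - y, s⟫| ≤ ‖x - y‖ := by
    simpa [hs] using abs_real_inner_le_norm (x - y) s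
  have h3 : |⟪y, s⟫| ≤ R := by
    have := abs_real_inner_le_norm y s
    rw [hs, mul_one] at this
    exact this.trans hy
  have h4 : |‖x‖ ^ 2 - b ^ 2| ≤ R ^ 2 + b ^ 2 := by
    rw [abs_le]; constructor <;> nlinarith [sq_nonneg b, sq_nonneg R]
  have h5 : |‖x‖ ^ 2 - ‖y‖ ^ 2| ≤ 2 * R * ‖x - y‖ := by
    rw [sq_sub_sq, abs_mul, abs_of_nonneg (add_nonneg hx0 hy0)]
    exact mul_le_mul (by linarith) hxy (abs_nonneg _) (by positivity)
  have h6 : (‖x‖ ^ 2 - b ^ 2) * ⟪x - y, s⟫ ≤ (R ^ 2 + b ^ 2) * ‖x - y‖ := by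
    refine (le_abs_self _).trans ?_
    rw [abs_mul]
    exact mul_le_mul h4 h2 (abs_nonneg _) (by positivity)
  have h7 : (‖x‖ ^ 2 - ‖y‖ ^ 2) * ⟪y, s⟫ ≤ 2 * R * ‖x - y‖ * R := by
    refine (le_abs_self _).trans ?_
    rw [abs_mul]
    exact mul_le_mul h5 h3 (abs_nonneg _) (by positivity)
  rw [inner_sub_left] at h6
  have h8 := (abs_le.1 h1).1
  nlinarith

lemma one_spin {N : ℕ} (hN : 2 ≤ N) {μ : Measure (UnitSphere N)} [IsProbabilityMeasure μ]
    (hμ : RotInv μ) (i : Fin N) (x : EuclideanSpace ℝ (Fin N)) :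
    ∫ s : UnitSphere N, Real.exp ⟪x, (s : EuclideanSpace ℝ (Fin N))⟫ *
      (⟪x, (s : EuclideanSpace ℝ (Fin N))⟫ - kfun μ i ‖x‖ * ‖x‖ ^ 2) ∂μ = 0 := by
  have h := integral_transport hμ x (‖x‖ • EuclideanSpace.single i (1:ℝ))
    (by simp [norm_smul]) (h := fun t => Real.exp t * (t - kfun μ i ‖x‖ * ‖x‖ ^ 2))
    (by fun_prop)
  rw [h]
  have e : ∫ s : UnitSphere N, Real.exp ⟪‖x‖ • EuclideanSpace.single i (1:ℝ),
        (s : EuclideanSpace ℝ (Fin N))⟫ *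
      (⟪‖x‖ • EuclideanSpace.single i (1:ℝ), (s : EuclideanSpace ℝ (Fin N))⟫
        - kfun μ i ‖x‖ * ‖x‖ ^ 2) ∂μ =
      ‖x‖ * Mom μ i 1 ‖x‖ - kfun μ i ‖x‖ * ‖x‖ ^ 2 * Mom μ i 0 ‖x‖ := by
    unfold Mom
    rw [← integral_const_mul, ← integral_const_mul, ← integral_sub
      (integrable_cont μ (by fun_prop)) (integrable_cont μ (by fun_prop))]
    congr 1
    ext s
    simp only [inner_smul_left, EuclideanSpace.inner_single_left]
    simp
    ring
  rw [e, Mom_one hN hμ]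
  ring

lemma resample {N : ℕ} (hN : 2 ≤ N) {μ : Measure (UnitSphere N)} [IsProbabilityMeasure μ]
    (hμ : RotInv μ) (i : Fin N) (c : ℝ) {H : EuclideanSpace ℝ (Fin N) → ℝ} (hH : Continuous H)
    {n : ℕ} (l : Fin n) :
    ∫ σ : Fin n → UnitSphere N, Real.exp (c * ‖totalSpin σ‖ ^ 2) *
      (H ((2 * c) • (totalSpin σ - σ l)) *
        (⟪(2 * c) • (totalSpin σ - σ l), (σ l : EuclideanSpace ℝ (Fin N))⟫ -
          kfun μ i ‖(2 * c) • (totalSpin σ - σ l)‖ * ‖(2 * c) • (totalSpin σ - σ l)‖ ^ 2))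
      ∂(Measure.pi fun _ : Fin n => μ) = 0 := by
  obtain ⟨m, rfl⟩ : ∃ m, n = m + 1 := ⟨n - 1, by have := l.2; omega⟩
  have hk := (contDiff_kfun μ i).continuous
  let T : (Fin m → UnitSphere N) → EuclideanSpace ℝ (Fin N) := fun τ =>
    ∑ j, (τ j : EuclideanSpace ℝ (Fin N))
  have hT : Continuous T := by simp only [T]; fun_prop
  let g : UnitSphere N × (Fin m → UnitSphere N) → ℝ := fun z =>
    Real.exp (c * ‖(z.1 : EuclideanSpace ℝ (Fin N)) + T z.2‖ ^ 2) *
      (H ((2 * c) • T z.2) * (⟪(2 * c) • T z.2, (z.1 : EuclideanSpace ℝ (Fin N))⟫ -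
          kfun μ i ‖(2 * c) • T z.2‖ * ‖(2 * c) • T z.2‖ ^ 2))
  have hg : Continuous g := by simp only [g]; fun_prop
  have hmp := measurePreserving_piFinSuccAbove (fun _ : Fin (m + 1) => μ) l
  have h1 := hmp.integral_comp' g
  have h2 : ∫ z, g z ∂(μ.prod (Measure.pi fun _ : Fin m => μ)) = 0 := by
    rw [integral_prod_symm _ (integrable_cont _ hg)]
    apply integral_eq_zero_of_ae
    refine Filter.Eventually.of_forall fun τ => ?_
    have e : ∀ s : UnitSphere N, g (s, τ) =
        (Real.exp (c * (1 + ‖T τ‖ ^ 2)) * H ((2 * c) • T τ)) *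
        (Real.exp ⟪(2 * c) • T τ, (s : EuclideanSpace ℝ (Fin N))⟫ *
          (⟪(2 * c) • T τ, (s : EuclideanSpace ℝ (Fin N))⟫ -
          kfun μ i ‖(2 * c) • T τ‖ * ‖(2 * c) • T τ‖ ^ 2)) := by
      intro s
      have hs : ‖(s : EuclideanSpace ℝ (Fin N))‖ = 1 := mem_sphere_zero_iff_norm.mp s.2
      have : Real.exp (c * ‖(s : EuclideanSpace ℝ (Fin N)) + T τ‖ ^ 2) =
          Real.exp (c * (1 + ‖T τ‖ ^ 2)) *
            Real.exp ⟪(2 * c) • T τ, (s : EuclideanSpace ℝ (Fin N))⟫ := by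
        rw [← Real.exp_add, norm_add_sq_real, hs, real_inner_comm, inner_smul_left]
        congr 1
        simp
        ring
      simp only [g]
      rw [this]
      ring
    simp only [e, Pi.zero_apply]
    rw [integral_const_mul, one_spin hN hμ i, mul_zero]
  rw [← h2, ← h1]
  congr 1
  ext σ
  have hS : totalSpin σ = (σ l : EuclideanSpace ℝ (Fin N)) +
      ∑ j, (σ (l.succAbove j) : EuclideanSpace ℝ (Fin N)) := by
    unfold totalSpin
    rw [Fin.sum_univ_succAbove _ l]
  rw [hS, add_sub_cancel_left]
  rfl

lemma gibbsWeight_eq (N n : ℕ) (β : ℝ) (σ : Fin n → UnitSphere N) :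
    gibbsWeight N n β σ = Real.exp (β / (2 * n) * ‖totalSpin σ‖ ^ 2) := by
  unfold gibbsWeight totalSpin
  rw [← real_inner_self_eq_norm_sq, sum_inner]
  simp_rw [inner_sum]

lemma Z_lower {N : ℕ} (μ : Measure (UnitSphere N)) [IsProbabilityMeasure μ] (i : Fin N)
    {β b : ℝ} (hβ : 0 < β) {n : ℕ} (hn : 1 ≤ n) :
    Real.exp (n * (Real.log (Mom μ i 0 b) - b ^ 2 / (2 * β))) ≤
    ∫ σ : Fin n → UnitSphere N, Real.exp (β / (2 * n) * ‖totalSpin σ‖ ^ 2)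
      ∂(Measure.pi fun _ : Fin n => μ) := by
  have hn0 : (0:ℝ) < n := by exact_mod_cast hn
  have hTc : Continuous (fun σ : Fin n → UnitSphere N => totalSpin σ) := by
    unfold totalSpin; fun_prop
  have e : Real.exp (n * (Real.log (Mom μ i 0 b) - b ^ 2 / (2 * β))) =
      ∫ σ : Fin n → UnitSphere N, Real.exp (-(n * (b ^ 2 / (2 * β)))) *
        ∏ j, Real.exp (b * (σ j : EuclideanSpace ℝ (Fin N)) i)
      ∂(Measure.pi fun _ : Fin n => μ) := by
    rw [integral_const_mul, integral_fintype_prod_eq_pow (ι := Fin n)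
      (fun s : UnitSphere N => Real.exp (b * (s : EuclideanSpace ℝ (Fin N)) i))]
    have : ∫ s : UnitSphere N, Real.exp (b * (s : EuclideanSpace ℝ (Fin N)) i) ∂μ =
      Mom μ i 0 b := by simp [Mom]
    rw [this, mul_sub, sub_eq_add_neg, Real.exp_add, mul_comm, Fintype.card_fin,
      mul_comm (n:ℝ) (Real.log _), Real.exp_mul, Real.exp_log (Mom_zero_pos μ i b),
      Real.rpow_natCast]
  rw [e]
  apply integral_mono (integrable_cont _ (by fun_prop)) (integrable_cont _ (by fun_prop))
  intro σ
  simp only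
  rw [← Real.exp_sum, ← Real.exp_add]
  apply Real.exp_le_exp.2
  rw [← Finset.mul_sum]
  have h1 : ∑ j, (σ j : EuclideanSpace ℝ (Fin N)) i = totalSpin σ i := by
    unfold totalSpin; simp
  rw [h1]
  have h2 : (totalSpin σ i) ^ 2 ≤ ‖totalSpin σ‖ ^ 2 := by
    have := PiLp.norm_apply_le (totalSpin σ) i
    rw [← sq_abs]
    exact pow_le_pow_left₀ (abs_nonneg _) this 2
  have h3 : β / (2 * n) * (totalSpin σ i) ^ 2 ≤ β / (2 * n) * ‖totalSpin σ‖ ^ 2 := by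
    gcongr
  have h4 : β / (2 * n) * (totalSpin σ i) ^ 2 - (-(n * (b ^ 2 / (2 * β))) + b * totalSpin σ i) =
      β / (2 * n) * (totalSpin σ i - b * n / β) ^ 2 := by
    field_simp; ring
  have h5 : 0 ≤ β / (2 * n) * (totalSpin σ i - b * n / β) ^ 2 := by positivity
  linarith
noncomputable section

set_option maxHeartbeats 2000000

/-- Second moment bound: `E|β|S_n|/n - b|² ≤ C/n` under the Gibbs measure. -/
theorem magnetization_second_moment_bound (N : ℕ) (hN : 2 ≤ N)
    (μ : Measure (UnitSphere N)) [IsProbabilityMeasure μ]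
    (hμinv : ∀ e : EuclideanSpace ℝ (Fin N) ≃ₗᵢ[ℝ] EuclideanSpace ℝ (Fin N),
      Measure.map (sphereMap e) μ = μ)
    (β : ℝ) (hβ : (N : ℝ) < β)
    (b : ℝ) (hb : 0 < b) (hbfix : b = β * besselRatio N b) :
    ∃ C > 0, ∀ n : ℕ, 1 ≤ n →
      (∫ σ, |β * ‖totalSpin σ‖ / n - b| ^ 2 ∂(gibbsMeasure N n β μ)) ≤ C / n := by
  have hμ : RotInv μ := hμinv
  have hN0 : (0:ℝ) < N := by exact_mod_cast (by omega : 0 < N)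
  have hβ0 : 0 < β := hN0.trans hβ
  let i : Fin N := ⟨0, by omega⟩
  have hk : β * kfun μ i b = 1 := by
    rw [besselRatio_eq hN hμ i] at hbfix
    have : b * (β * kfun μ i b) = b * 1 := by linarith
    exact mul_left_cancel₀ hb.ne' this
  have hfe := free_energy_pos hN hμ i hβ0 hb hk
  obtain ⟨c, hc, hquad⟩ := quad_lower hN hμ i hβ0 hb hk
  obtain ⟨K, hK0, hK⟩ := Psi_lip μ i b (2 * β)
  set ρ := Real.log (Mom μ i 0 b) - b ^ 2 / (2 * β) with hρ
  have hρ0 : 0 < ρ := by rw [hρ]; linarith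
  set δ := min b (Real.sqrt (β * ρ)) with hδ
  have hδ0 : 0 < δ := lt_min hb (Real.sqrt_pos.2 (by positivity))
  have hδb : δ ≤ b := min_le_left _ _
  have hδρ : δ ^ 2 ≤ β * ρ := by
    have h1 : δ ≤ Real.sqrt (β * ρ) := min_le_right _ _
    have := pow_le_pow_left₀ hδ0.le h1 2
    rwa [Real.sq_sqrt (by positivity)] at this
  refine ⟨1 / (δ ^ 2 * c) * (K * β ^ 2) + b ^ 2 * (2 / ρ), by positivity, fun n hn => ?_⟩
  have hn0 : (0:ℝ) < n := by exact_mod_cast hn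
  have hn1 : (1:ℝ) ≤ n := by exact_mod_cast hn
  have hTc : Continuous (fun σ : Fin n → UnitSphere N => totalSpin σ) := by
    unfold totalSpin; fun_prop
  have hkc := (contDiff_kfun μ i).continuous
  have hZl := Z_lower μ i (b := b) hβ0 hn
  rw [← hρ] at hZl
  have hgw : gibbsWeight N n β = fun σ => Real.exp (β / (2 * n) * ‖totalSpin σ‖ ^ 2) :=
    funext fun σ => gibbsWeight_eq N n β σ
  unfold gibbsMeasure
  rw [hgw]
  set w : (Fin n → UnitSphere N) → ℝ := fun σ => Real.exp (β / (2 * n) * ‖totalSpin σ‖ ^ 2)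
    with hw
  have hwc : Continuous w := by simp only [hw]; fun_prop
  set P : Measure (Fin n → UnitSphere N) := Measure.pi fun _ : Fin n => μ with hP
  set Z := ∫ τ, w τ ∂P with hZ
  have hZ0 : 0 < Z := lt_of_lt_of_le (Real.exp_pos _) hZl
  rw [integral_withDensity_eq_integral_toReal_smul (by fun_prop)
    (Filter.Eventually.of_forall fun _ => ENNReal.ofReal_lt_top)]
  -- the pointwise estimate
  let ψ : Fin n → (Fin n → UnitSphere N) → ℝ := fun l σ =>
    w σ * ((‖(2 * (β / (2 * n))) • (totalSpin σ - σ l)‖ ^ 2 - b ^ 2) *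
        (⟪(2 * (β / (2 * n))) • (totalSpin σ - σ l), (σ l : EuclideanSpace ℝ (Fin N))⟫ -
          kfun μ i ‖(2 * (β / (2 * n))) • (totalSpin σ - σ l)‖ *
            ‖(2 * (β / (2 * n))) • (totalSpin σ - σ l)‖ ^ 2))
  have hψ0 : ∀ l, ∫ σ, ψ l σ ∂P = 0 := fun l =>
    resample hN hμ i (β / (2 * n)) (H := fun x => ‖x‖ ^ 2 - b ^ 2) (by fun_prop) l
  have hψc : ∀ l, Continuous (ψ l) := by
    intro l
    simp only [ψ]
    fun_prop
  have hpt : ∀ σ, w σ * (β * ‖totalSpin σ‖ / n - b) ^ 2 ≤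
      1 / (δ ^ 2 * c) * (β / n * ∑ l, ψ l σ + K * β ^ 2 / n * w σ) +
        b ^ 2 * Real.exp (n * (ρ / 2)) := by
    intro σ
    have hw0 : 0 < w σ := Real.exp_pos _
    set S := totalSpin σ with hS
    set κ := 2 * (β / (2 * n)) with hκ
    have hκ' : κ = β / n := by rw [hκ]; field_simp
    have hκ0 : 0 < κ := by rw [hκ']; positivity
    have hσ : ∀ l, ‖(σ l : EuclideanSpace ℝ (Fin N))‖ = 1 := fun l =>
      mem_sphere_zero_iff_norm.mp (σ l).2
    have hSn : ‖S‖ ≤ n := by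
      rw [hS]; unfold totalSpin
      refine (norm_sum_le _ _).trans ?_
      simp [hσ]
    set m := κ • S with hm
    have hmn : ‖m‖ = β * ‖S‖ / n := by
      rw [hm, norm_smul, Real.norm_eq_abs, abs_of_pos hκ0, hκ']; ring
    set r := β * ‖S‖ / n with hr
    have hr0 : 0 ≤ r := by rw [← hmn]; exact norm_nonneg _
    have hrβ : r ≤ β := by
      rw [hr, div_le_iff₀ hn0]; gcongr
    have hwr : w σ = Real.exp (n * (r ^ 2 / (2 * β))) := by
      simp only [hw, ← hS, hr]
      congr 1; field_simp
    have hq := hquad r ⟨hr0, hrβ⟩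
    have hq0 : 0 ≤ (r ^ 2 - b ^ 2) * (1 - β * kfun μ i r) :=
      le_trans (by positivity) hq
    -- comparison with the resampled quantity
    have hcmp : w σ * (r ^ 2 * ((r ^ 2 - b ^ 2) * (1 - β * kfun μ i r))) ≤
        β / n * ∑ l, ψ l σ + K * β ^ 2 / n * w σ := by
      have e1 : r ^ 2 * ((r ^ 2 - b ^ 2) * (1 - β * kfun μ i r)) =
          β / n * ∑ l, (‖m‖ ^ 2 - b ^ 2) * (⟪m, (σ l : EuclideanSpace ℝ (Fin N))⟫ -
            kfun μ i ‖m‖ * ‖m‖ ^ 2) := by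
        rw [← Finset.mul_sum, Finset.sum_sub_distrib, ← inner_sum]
        have : ⟪m, ∑ l, (σ l : EuclideanSpace ℝ (Fin N))⟫ = r ^ 2 * n / β := by
          change ⟪m, S⟫ = _
          rw [hm, inner_smul_left, real_inner_self_eq_norm_sq, hκ', hr]
          simp
          field_simp
        rw [this, hmn]
        simp
        field_simp
      have e2 : ∀ l, (‖m‖ ^ 2 - b ^ 2) * (⟪m, (σ l : EuclideanSpace ℝ (Fin N))⟫ -
            kfun μ i ‖m‖ * ‖m‖ ^ 2) ≤ (‖κ • (S - σ l)‖ ^ 2 - b ^ 2) *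
            (⟪κ • (S - σ l), (σ l : EuclideanSpace ℝ (Fin N))⟫ -
              kfun μ i ‖κ • (S - σ l)‖ * ‖κ • (S - σ l)‖ ^ 2) + K * (β / n) := by
        intro l
        have hd : m - κ • (S - σ l) = κ • (σ l : EuclideanSpace ℝ (Fin N)) := by
          rw [hm, smul_sub]; abel
        have hdn : ‖κ • (σ l : EuclideanSpace ℝ (Fin N))‖ = β / n := by
          rw [norm_smul, hσ, mul_one, Real.norm_eq_abs, abs_of_pos hκ0, hκ']
        have hβn : β / n ≤ β := div_le_self hβ0.le hn1
        have h := hK m (κ • (S - σ l)) (σ l) (by rw [hmn]; linarith) (by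
          have : κ • (S - (σ l : EuclideanSpace ℝ (Fin N))) =
            m - κ • (σ l : EuclideanSpace ℝ (Fin N)) := by rw [hm, smul_sub]
          rw [this]
          refine (norm_sub_le _ _).trans ?_
          rw [hdn, hmn]; linarith) (hσ l)
        rwa [hd, hdn] at h
      have e3 := Finset.sum_le_sum (s := Finset.univ) (fun l _ => e2 l)
      rw [Finset.sum_add_distrib] at e3
      simp only [Finset.sum_const, Finset.card_univ, Fintype.card_fin, nsmul_eq_mul] at e3
      have e4 : ∑ l, ψ l σ = w σ * ∑ l, (‖κ • (S - σ l)‖ ^ 2 - b ^ 2) *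
            (⟪κ • (S - σ l), (σ l : EuclideanSpace ℝ (Fin N))⟫ -
              kfun μ i ‖κ • (S - σ l)‖ * ‖κ • (S - σ l)‖ ^ 2) := by
        rw [Finset.mul_sum]
      rw [e1, e4]
      have e5 := mul_le_mul_of_nonneg_left e3 (show 0 ≤ w σ * (β / n) by positivity)
      have e6 : w σ * (β / n) * (n * (K * (β / n))) = K * β ^ 2 / n * w σ := by field_simp
      rw [mul_add, e6] at e5
      linear_combination e5
    have hexp : 0 < Real.exp (n * (ρ / 2)) := Real.exp_pos _
    have hcmp' := mul_le_mul_of_nonneg_left hcmp (show 0 ≤ 1 / (δ ^ 2 * c) by positivity)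
    by_cases hrδ : r < δ
    · have h1 : (r - b) ^ 2 ≤ b ^ 2 := by
        have := mul_nonneg hr0 (show 0 ≤ 2 * b - r by linarith)
        linear_combination this
      have h2 : w σ ≤ Real.exp (n * (ρ / 2)) := by
        rw [hwr]
        apply Real.exp_le_exp.2
        apply mul_le_mul_of_nonneg_left _ hn0.le
        rw [div_le_iff₀ (by positivity)]
        have := pow_le_pow_left₀ hr0 hrδ.le 2
        linear_combination this + hδρ
      have h3 : w σ * (r - b) ^ 2 ≤ Real.exp (n * (ρ / 2)) * b ^ 2 :=
        mul_le_mul h2 h1 (sq_nonneg _) hexp.le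
      have h4 : 0 ≤ 1 / (δ ^ 2 * c) *
          (w σ * (r ^ 2 * ((r ^ 2 - b ^ 2) * (1 - β * kfun μ i r)))) := by positivity
      linarith
    · push Not at hrδ
      have h1 : δ ^ 2 * (c * (r - b) ^ 2) ≤
          r ^ 2 * ((r ^ 2 - b ^ 2) * (1 - β * kfun μ i r)) :=
        mul_le_mul (pow_le_pow_left₀ hδ0.le hrδ 2) hq (by positivity) (by positivity)
      have h2 : w σ * (r - b) ^ 2 ≤ 1 / (δ ^ 2 * c) *
          (w σ * (r ^ 2 * ((r ^ 2 - b ^ 2) * (1 - β * kfun μ i r)))) := by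
        calc w σ * (r - b) ^ 2 = 1 / (δ ^ 2 * c) * (w σ * (δ ^ 2 * (c * (r - b) ^ 2))) := by
              field_simp
          _ ≤ _ := by gcongr
      have h3 : 0 ≤ b ^ 2 * Real.exp (n * (ρ / 2)) := by positivity
      linarith
  have hIntBound : ∫ σ, w σ * (β * ‖totalSpin σ‖ / n - b) ^ 2 ∂P ≤
      1 / (δ ^ 2 * c) * (K * β ^ 2 / n * Z) + b ^ 2 * Real.exp (n * (ρ / 2)) := by
    have h1 := integral_mono (μ := P) (integrable_cont P (by fun_prop))
      (integrable_cont P (by fun_prop)) hpt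
    refine h1.trans (le_of_eq ?_)
    rw [integral_add (integrable_cont P (by fun_prop)) (integrable_cont P (by fun_prop)),
      integral_const_mul, integral_add (integrable_cont P (by fun_prop))
      (integrable_cont P (by fun_prop)), integral_const_mul, integral_const_mul,
      integral_finsetSum _ (fun l _ => integrable_cont P (hψc l))]
    simp [hψ0, hZ]
  have hexpZ : Real.exp (n * (ρ / 2)) / Z ≤ 2 / ρ / n := by
    have h1 : Real.exp (n * (ρ / 2)) * Real.exp (n * (ρ / 2)) ≤ Z := by
      rw [← Real.exp_add]
      refine le_trans (le_of_eq ?_) hZl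
      congr 1; ring
    have h2 : n * (ρ / 2) ≤ Real.exp (n * (ρ / 2)) := by
      linarith [Real.add_one_le_exp (n * (ρ / 2))]
    have h3 : 0 < Real.exp (n * (ρ / 2)) := Real.exp_pos _
    rw [div_le_iff₀ hZ0]
    have h4 : Real.exp (n * (ρ / 2)) * (n * (ρ / 2)) ≤ Z :=
      le_trans (mul_le_mul_of_nonneg_left h2 h3.le) h1
    calc Real.exp (n * (ρ / 2)) = 2 / ρ / n * (Real.exp (n * (ρ / 2)) * (n * (ρ / 2))) := by
          field_simp
      _ ≤ _ := by gcongr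
  have e : ∀ σ : Fin n → UnitSphere N, (ENNReal.ofReal (w σ / Z)).toReal •
      |β * ‖totalSpin σ‖ / n - b| ^ 2 = (w σ * (β * ‖totalSpin σ‖ / n - b) ^ 2) / Z := by
    intro σ
    have hw0 : 0 < w σ := Real.exp_pos _
    rw [ENNReal.toReal_ofReal (by positivity), sq_abs, smul_eq_mul]
    ring
  simp_rw [e]
  rw [integral_div]
  calc _ ≤ (1 / (δ ^ 2 * c) * (K * β ^ 2 / n * Z) + b ^ 2 * Real.exp (n * (ρ / 2))) / Z := by
        gcongr
    _ = 1 / (δ ^ 2 * c) * (K * β ^ 2) / n + b ^ 2 * (Real.exp (n * (ρ / 2)) / Z) := by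
        field_simp
    _ ≤ 1 / (δ ^ 2 * c) * (K * β ^ 2) / n + b ^ 2 * (2 / ρ / n) := by gcongr
    _ = _ := by ring

end
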